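/- Let n ≥ 2 and k ≥ 2. If G is a group of permutations of ℚ^n that properly contains AGL_n(ℚ), then G does not preserve any Steiner k-system on ℚ^n. -/

import Mathlib

/-- `σ` is an element of `AGL_n(ℚ)`: a permutation of `ℚ^n` of the form
`x ↦ T x + b` with `T` an invertible `ℚ`-linear map and `b ∈ ℚ^n`. -/
def IsAGL (n : ℕ) (σ : Equiv.Perm (Fin n → ℚ)) : Prop :=
  ∃ T : (Fin n → ℚ) ≃ₗ[ℚ] (Fin n → ℚ), ∃ b : Fin n → ℚ, ∀ x, σ x = T x + b

/-- `(X, B)` is a Steiner `k`-system: all blocks have the same cardinality,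
every block has more than `k` elements, there is more than one block, and any
`k` pairwise distinct points lie in a unique block. -/
def IsSteinerSystem {X : Type*} (k : ℕ) (B : Set (Set X)) : Prop :=
  (∀ b₁ ∈ B, ∀ b₂ ∈ B, Cardinal.mk b₁ = Cardinal.mk b₂) ∧
  (∀ b ∈ B, (k : Cardinal) < Cardinal.mk b) ∧
  (∃ b₁ ∈ B, ∃ b₂ ∈ B, b₁ ≠ b₂) ∧
  (∀ f : Fin k → X, Function.Injective f → ∃! b, b ∈ B ∧ ∀ i, f i ∈ b)

/-- Every invertible affine map sends blocks to blocks. -/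
def AffineInvariant {V : Type*} [AddCommGroup V] [Module ℚ V] (B : Set (Set V)) : Prop :=
  ∀ (T : V ≃ₗ[ℚ] V) (c : V), ∀ b ∈ B, (fun x => T x + c) '' b ∈ B

/-- The set of points `a + t • e`, a line when `e ≠ 0`. -/
def lineThrough {V : Type*} [AddCommGroup V] [Module ℚ V] (a e : V) : Set V :=
  Set.range fun t : ℚ => a + t • e

section Steiner

variable {X : Type*} {k : ℕ} {B : Set (Set X)}

lemma IsSteinerSystem.exists_block (hS : IsSteinerSystem k B) {A : Finset X} (hA : A.card = k) :
    ∃ b ∈ B, ↑A ⊆ b := by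
  obtain ⟨b, ⟨hb, h⟩, -⟩ := hS.2.2.2 (fun i => ((A.equivFinOfCardEq hA).symm i : X))
    (Subtype.val_injective.comp (Equiv.injective _))
  refine ⟨b, hb, fun x hx => ?_⟩
  simpa using h (A.equivFinOfCardEq hA ⟨x, hx⟩)

lemma IsSteinerSystem.block_unique (hS : IsSteinerSystem k B) {A : Finset X} (hA : A.card = k)
    {b b' : Set X} (hb : b ∈ B) (hb' : b' ∈ B) (h : ↑A ⊆ b) (h' : ↑A ⊆ b') : b = b' := by
  refine (hS.2.2.2 (fun i => ((A.equivFinOfCardEq hA).symm i : X))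
    (Subtype.val_injective.comp (Equiv.injective _))).unique ⟨hb, fun i => h ?_⟩
      ⟨hb', fun i => h' ?_⟩ <;> exact Subtype.coe_prop _

lemma IsSteinerSystem.exists_finset_subset (hS : IsSteinerSystem k B) {b : Set X} (hb : b ∈ B) :
    ∃ A : Finset X, A.card = k + 1 ∧ ↑A ⊆ b := by
  have h : ((k + 1 : ℕ) : Cardinal) ≤ Cardinal.mk b := by
    have := hS.2.1 b hb
    rw [Nat.cast_succ, ← Cardinal.succ_natCast]
    exact Order.succ_le_of_lt this
  obtain ⟨A, hA⟩ := Cardinal.exists_finset_eq_card h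
  exact ⟨A.map (Function.Embedding.subtype _), by simpa using hA.symm, by simp⟩

lemma IsSteinerSystem.ne_univ (hS : IsSteinerSystem k B) {b : Set X} (hb : b ∈ B) :
    b ≠ Set.univ := by
  rintro rfl
  have key : ∀ b ∈ B, b = Set.univ := fun b' hb' => by
    obtain ⟨A, hA, hAb⟩ := hS.exists_finset_subset hb'
    obtain ⟨A', hA', hc⟩ := Finset.exists_subset_card_eq (hA ▸ k.le_succ : k ≤ A.card)
    exact hS.block_unique hc hb' hb ((Finset.coe_subset.2 hA').trans hAb) (Set.subset_univ _)
  obtain ⟨b₁, h₁, b₂, h₂, hne⟩ := hS.2.2.1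
  exact hne ((key b₁ h₁).trans (key b₂ h₂).symm)

end Steiner

section Affine

variable {V : Type*} [AddCommGroup V] [Module ℚ V] {k : ℕ} {B : Set (Set V)}

lemma mem_lineThrough {a e x : V} : x ∈ lineThrough a e ↔ x - a ∈ Submodule.span ℚ {e} := by
  rw [Submodule.mem_span_singleton]
  constructor
  · rintro ⟨t, rfl⟩
    exact ⟨t, by simp⟩
  · rintro ⟨t, ht⟩
    exact ⟨t, by simp [ht]⟩

lemma exists_dual_vanishing {ι : Type*} [Finite ι] (e : V) (v : ι → V)
    (hv : ∀ i, v i ∉ Submodule.span ℚ {e}) :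
    ∃ φ : V →ₗ[ℚ] ℚ, φ e = 0 ∧ ∀ i, φ (v i) ≠ 0 := by
  obtain ⟨f, hf⟩ := Module.exists_dual_forall_apply_ne_zero (K := ℚ)
    (fun i => (Submodule.span ℚ {e}).mkQ (v i)) (fun i => by simpa using hv i)
  refine ⟨f ∘ₗ (Submodule.span ℚ {e}).mkQ, ?_, hf⟩
  have : (Submodule.span ℚ {e}).mkQ e = 0 := by
    simp
  rw [LinearMap.comp_apply, this, map_zero]

lemma exists_linearEquiv_add_smul (φ : V →ₗ[ℚ] ℚ) {q q' : V} (hq : φ q ≠ 0) (hq' : φ q' ≠ 0) :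
    ∃ T : V ≃ₗ[ℚ] V, ∀ x, T x = x + (φ x / φ q) • (q' - q) := by
  refine ⟨LinearEquiv.ofLinearMap (LinearMap.id + ((φ q)⁻¹ • φ).smulRight (q' - q))
    (LinearMap.id + ((φ q')⁻¹ • φ).smulRight (q - q')) ?_ ?_, fun x => ?_⟩
  · ext x
    simp only [LinearMap.comp_apply, LinearMap.add_apply, LinearMap.id_apply,
      LinearMap.smulRight_apply, LinearMap.smul_apply, map_add, map_smul, map_sub, smul_eq_mul]
    match_scalars <;> field_simp <;> ring
  · ext x
    simp only [LinearMap.comp_apply, LinearMap.add_apply, LinearMap.id_apply,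
      LinearMap.smulRight_apply, LinearMap.smul_apply, map_add, map_smul, map_sub, smul_eq_mul]
    match_scalars <;> field_simp <;> ring
  · simp [div_eq_inv_mul]

lemma image_eq_of_subset (hS : IsSteinerSystem k B) (hB : AffineInvariant B) {b : Set V}
    (hb : b ∈ B) {A : Finset V} (hA : A.card = k) (hAb : ↑A ⊆ b) (T : V ≃ₗ[ℚ] V) (c : V)
    (hT : ∀ x ∈ A, T x + c ∈ b) : (fun x => T x + c) '' b = b := by
  classical
  refine hS.block_unique (A := A.image fun x => T x + c) ?_ (hB T c b hb) hb ?_ ?_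
  · rw [Finset.card_image_of_injective _ fun x y h => T.injective (add_right_cancel h), hA]
  · rw [Finset.coe_image]
    exact Set.image_mono hAb
  · rw [Finset.coe_image]
    rintro _ ⟨x, hx, rfl⟩
    exact hT x hx

/-- A block with `k` points on a line is contained in that line. -/
lemma block_subset_line (hS : IsSteinerSystem k B) (hB : AffineInvariant B) {b : Set V}
    (hb : b ∈ B) {A : Finset V} (hA : A.card = k) (hAb : ↑A ⊆ b) {a e : V}
    (hAl : ↑A ⊆ lineThrough a e) : b ⊆ lineThrough a e := by
  classical
  intro z hz
  by_contra hzl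
  have hcompl : ∀ x ∉ lineThrough a e, x ∈ b := fun x hx => by
    rw [mem_lineThrough] at hx hzl
    obtain ⟨φ, hφe, hφ⟩ := exists_dual_vanishing e ![z - a, x - a] (by
      intro i; fin_cases i <;> assumption)
    obtain ⟨T, hT⟩ := exists_linearEquiv_add_smul φ (hφ 0) (hφ 1)
    have himg := image_eq_of_subset hS hB hb hA hAb T (a - T a) (fun y hy => by
      have hy' := hAl hy
      obtain ⟨t, rfl⟩ := hy'
      have : T e = e := by simp [hT, hφe]
      rw [map_add, map_smul, this]
      convert hAb hy using 1
      module)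
    rw [← himg]
    refine ⟨z, hz, ?_⟩
    have : T (z - a) = x - a := by
      rw [hT]
      have h0 := hφ 0
      simp only [Matrix.cons_val_zero, Matrix.cons_val_one] at h0 ⊢
      rw [div_self h0]
      simp
    rw [map_sub] at this
    simp only
    rw [add_sub, add_comm, ← add_sub, this]
    simp
  have hshift : ∀ y ∈ lineThrough a e, y + (z - a) ∉ lineThrough a e ∧
      y - (z - a) ∉ lineThrough a e := fun y hy => by
    rw [mem_lineThrough] at hy hzl
    simp only [mem_lineThrough]
    constructor
    · intro h
      apply hzl
      convert Submodule.sub_mem _ h hy using 1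
      abel
    · intro h
      apply hzl
      convert Submodule.sub_mem _ hy h using 1
      abel
  have himg := image_eq_of_subset hS hB hb hA hAb (LinearEquiv.refl ℚ V) (z - a) fun y hy =>
    hcompl _ (hshift y (hAl hy)).1
  refine hS.ne_univ hb (Set.eq_univ_of_forall fun y => ?_)
  by_cases hy : y ∈ lineThrough a e
  · rw [← himg]
    exact ⟨y - (z - a), hcompl _ (hshift y hy).2, by simp⟩
  · exact hcompl y hy

lemma natCast_smul_injective {e : V} (he : e ≠ 0) :
    Function.Injective fun i : ℕ => (i : ℚ) • e :=
  (smul_left_injective ℚ he).comp Nat.cast_injective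

/-- Iterating a transvection-like map sending `x` to `y` produces infinitely many points of a
block on the line through `x` and `y`. -/
lemma block_subset_line_of_image_eq (hS : IsSteinerSystem k B) (hB : AffineInvariant B)
    {b : Set V} (hb : b ∈ B) {x y : V} (hx : x ∈ b) (φ : V →ₗ[ℚ] ℚ) (hφx : φ x ≠ 0)
    (hφxy : φ (x + y) ≠ 0) (hxy : x ≠ y) (T : V ≃ₗ[ℚ] V)
    (hT : ∀ z, T z = z + (φ z / φ x) • (y - x)) (hTb : ∀ z ∈ b, T z ∈ b) :
    b ⊆ lineThrough x (y - x) := by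
  classical
  set ρ : ℚ := φ y / φ x with hρ
  have hρ1 : ρ ≠ -1 := by
    rw [hρ, ne_eq, div_eq_iff hφx]
    intro h
    apply hφxy
    rw [map_add, h]
    ring
  let c : ℕ → ℚ := fun i => ∑ j ∈ Finset.range i, ρ ^ j
  have hmem : ∀ i, x + c i • (y - x) ∈ b := by
    intro i
    induction i with
    | zero => simpa [c] using hx
    | succ i ih =>
      convert hTb _ ih using 1
      have h1 : c (i + 1) = ρ * c i + 1 := geom_sum_succ
      have h2 : φ (x + c i • (y - x)) / φ x = 1 + c i * (ρ - 1) := by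
        rw [map_add, map_smul, map_sub, smul_eq_mul, hρ]
        field_simp
      rw [hT, h2, h1]
      module
  have hρ0 : ρ ≠ 0 := by
    intro h0
    have : φ y = 0 := by
      rw [hρ, div_eq_zero_iff] at h0
      exact h0.resolve_right hφx
    have hTx : T x = T 0 + y := by rw [hT, map_zero, div_self hφx]; module
    have : T (y - x) = T 0 := by
      rw [hT, map_sub, this, map_zero, zero_sub, neg_div, div_self hφx]
      module
    exact hxy (sub_eq_zero.1 (T.injective this)).symm
  have hne : ∀ i j, i < j → c i ≠ c j := by
    intro i j hij h
    obtain ⟨d, rfl⟩ := Nat.exists_eq_add_of_lt hij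
    have h3 : c (i + d + 1) = c i + ρ ^ i * ∑ j ∈ Finset.range (d + 1), ρ ^ j := by
      simp only [c]
      rw [add_assoc, Finset.sum_range_add, Finset.mul_sum]
      simp only [pow_add]
    rw [h3, left_eq_add, mul_eq_zero] at h
    rcases h with h | h
    · exact pow_ne_zero _ hρ0 h
    · exact geom_sum_ne_zero hρ1 (Nat.succ_ne_zero d) h
  have hinj : Function.Injective c := by
    intro i j h
    rcases lt_trichotomy i j with hij | hij | hij
    · exact (hne i j hij h).elim
    · exact hij
    · exact (hne j i hij h.symm).elim
  refine block_subset_line hS hB hb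
    (A := (Finset.range k).image fun i => x + c i • (y - x)) ?_ ?_ ?_
  · rw [Finset.card_image_of_injective, Finset.card_range]
    exact (add_right_injective x).comp ((smul_left_injective ℚ (sub_ne_zero.2 hxy.symm)).comp hinj)
  · intro z hz
    obtain ⟨i, -, rfl⟩ := Finset.mem_image.1 (Finset.mem_coe.1 hz)
    exact hmem i
  · intro z hz
    obtain ⟨i, -, rfl⟩ := Finset.mem_image.1 (Finset.mem_coe.1 hz)
    exact ⟨c i, rfl⟩

/-- For `k ≥ 3`, blocks of an affine invariant Steiner system have at most `k + 1` points. -/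
lemma card_le_of_subset_block (hS : IsSteinerSystem k B) (hB : AffineInvariant B) (hk : 3 ≤ k)
    {e q : V} (he : e ≠ 0) (hq : q ∉ Submodule.span ℚ {e}) {b : Set V} (hb : b ∈ B)
    {C : Finset V} (hC : ↑C ⊆ b) : C.card ≤ k + 1 := by
  classical
  let P : Finset V := (Finset.range (k - 1)).image fun i : ℕ => (i : ℚ) • e
  have hPcard : P.card = k - 1 := by
    rw [Finset.card_image_of_injective _ (natCast_smul_injective he), Finset.card_range]
  have hPspan : ∀ x ∈ P, x ∈ Submodule.span ℚ {e} := by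
    intro x hx
    obtain ⟨i, -, rfl⟩ := Finset.mem_image.1 hx
    exact Submodule.smul_mem _ _ (Submodule.mem_span_singleton_self e)
  have hcard : ∀ x ∉ P, (insert x P).card = k := fun x hx => by
    rw [Finset.card_insert_of_notMem hx, hPcard]
    omega
  have hqP : q ∉ P := fun h => hq (hPspan q h)
  obtain ⟨b₀, hb₀, hAb⟩ := hS.exists_block (hcard q hqP)
  have hPb : (P : Set V) ⊆ b₀ := fun x hx => hAb (Finset.mem_insert_of_mem hx)
  have hins : ∀ x ∈ b₀, ((insert x P : Finset V) : Set V) ⊆ b₀ := fun x hx => by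
    rw [Finset.coe_insert]
    exact Set.insert_subset hx hPb
  have hqb : q ∈ b₀ := hAb (Finset.mem_insert_self q P)
  have hoff : ∀ x ∈ b₀, x ∉ P → x ∉ Submodule.span ℚ {e} := by
    intro x hx hxP hxe
    have := block_subset_line hS hB hb₀ (hcard x hxP) (hins x hx) (a := 0) (e := e) (by
      intro z hz
      rw [mem_lineThrough, sub_zero]
      rcases Finset.mem_insert.1 (Finset.mem_coe.1 hz) with rfl | hz
      · exact hxe
      · exact hPspan z hz) hqb
    rw [mem_lineThrough, sub_zero] at this
    exact hq this
  have hadd : ∀ x ∈ b₀, ∀ y ∈ b₀, x ∉ P → y ∉ P → x ≠ y → x + y ∈ Submodule.span ℚ {e} := by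
    intro x hx y hy hxP hyP hxy
    by_contra hsum
    have hxe := hoff x hx hxP
    obtain ⟨φ, hφe, hφ⟩ := exists_dual_vanishing e ![x, y, x + y] (by
      intro i
      fin_cases i
      exacts [hxe, hoff y hy hyP, hsum])
    have hφx : φ x ≠ 0 := hφ 0
    obtain ⟨T, hT⟩ := exists_linearEquiv_add_smul φ hφx (hφ 1 : φ y ≠ 0)
    have himg := image_eq_of_subset hS hB hb₀ (hcard x hxP) (hins x hx) T 0 (by
      intro z hz
      rcases Finset.mem_insert.1 hz with rfl | hz
      · rw [hT, div_self hφx]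
        simpa using hy
      · obtain ⟨t, rfl⟩ := Submodule.mem_span_singleton.1 (hPspan z hz)
        rw [hT, map_smul, hφe]
        simpa using hPb hz)
    have hline := block_subset_line_of_image_eq hS hB hb₀ hx φ hφx (hφ 2) hxy T hT (fun z hz => by
      rw [← himg]
      exact ⟨z, hz, add_zero _⟩)
    have h0 : (0 : V) ∈ P := Finset.mem_image.2 ⟨0, Finset.mem_range.2 (by omega), by simp⟩
    have h1 : e ∈ P := Finset.mem_image.2 ⟨1, Finset.mem_range.2 (by omega), by simp⟩
    obtain ⟨s, hs⟩ := hline (hPb h0)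
    obtain ⟨t, ht⟩ := hline (hPb h1)
    simp only at hs ht
    have hst : e = (t - s) • (y - x) := by
      rw [← sub_zero e, ← hs, ← ht]
      module
    have hts : t - s ≠ 0 := by
      rintro h
      rw [h, zero_smul] at hst
      exact he hst
    apply hxe
    rw [Submodule.mem_span_singleton]
    refine ⟨-s * (t - s)⁻¹, ?_⟩
    rw [hst, smul_smul, mul_assoc, inv_mul_cancel₀ hts, mul_one, neg_smul]
    exact (eq_neg_of_add_eq_zero_left hs).symm
  have hb₀C : ∀ D : Finset V, ↑D ⊆ b₀ → D.card ≤ k + 1 := by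
    intro D hD
    by_contra! hlt
    have h2 : 2 < (D \ P).card := by
      have := Finset.le_card_sdiff P D
      omega
    obtain ⟨x, hx, y, hy, z, hz, hxy, hxz, hyz⟩ := Finset.two_lt_card.1 h2
    rw [Finset.mem_sdiff] at hx hy hz
    have h := Submodule.sub_mem _ (Submodule.add_mem _
      (hadd x (hD hx.1) y (hD hy.1) hx.2 hy.2 hxy) (hadd x (hD hx.1) z (hD hz.1) hx.2 hz.2 hxz))
      (hadd y (hD hy.1) z (hD hz.1) hy.2 hz.2 hyz)
    apply hoff x (hD hx.1) hx.2
    convert Submodule.smul_mem _ (1 / 2 : ℚ) h using 1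
    module
  obtain ⟨f⟩ := Cardinal.eq.1 (hS.1 b hb b₀ hb₀)
  have := hb₀C ((C.attach.map ⟨fun x : {x // x ∈ C} => f ⟨x, hC x.2⟩, fun x y h => by
    exact Subtype.ext (Subtype.mk.inj (f.injective h))⟩).map (Function.Embedding.subtype _)) (by simp)
  simpa using this

/-- If every block has at most `k + 1` points, the block containing a `k`-set symmetric about `c`
is obtained by adjoining `c`. -/
lemma center_mem_block (hS : IsSteinerSystem k B) (hB : AffineInvariant B)
    (hcard : ∀ b ∈ B, ∀ C : Finset V, ↑C ⊆ b → C.card ≤ k + 1) {b : Set V} (hb : b ∈ B)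
    {A : Finset V} (hA : A.card = k) (hAb : ↑A ⊆ b) (c : V)
    (hsymm : ∀ x ∈ A, (2 : ℚ) • c - x ∈ A) : c ∉ A ∧ c ∈ b := by
  classical
  obtain ⟨C, hC, hCb⟩ := hS.exists_finset_subset hb
  obtain ⟨z, hzC, hzA⟩ := Finset.exists_mem_notMem_of_card_lt_card (by omega : A.card < C.card)
  have hz := hCb hzC
  have himg := image_eq_of_subset hS hB hb hA hAb (LinearEquiv.neg ℚ) ((2 : ℚ) • c) (by
    intro x hx
    have := hAb (hsymm x hx)
    rwa [sub_eq_neg_add] at this)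
  have hz' : (2 : ℚ) • c - z ∈ b := by
    rw [← himg]
    exact ⟨z, hz, by simp [sub_eq_neg_add]⟩
  have hz'A : (2 : ℚ) • c - z ∉ A := by
    intro h
    apply hzA
    simpa using hsymm _ h
  have heq : (2 : ℚ) • c - z = z := by
    by_contra hne
    have := hcard b hb (insert ((2 : ℚ) • c - z) (insert z A)) (by
      rw [Finset.coe_insert, Finset.coe_insert]
      exact Set.insert_subset hz' (Set.insert_subset hz hAb))
    rw [Finset.card_insert_of_notMem (by simp [hne, hz'A]), Finset.card_insert_of_notMem hzA] at this
    omega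
  have hcz : c = z := by
    have : c = (1 / 2 : ℚ) • ((2 : ℚ) • c - z + z) := by module
    rw [this, heq]
    module
  exact hcz ▸ ⟨hzA, hz⟩

/-- There is no affine invariant Steiner `k`-system with `k ≥ 3`. -/
lemma not_affineInvariant_of_three_le (hS : IsSteinerSystem k B) (hk : 3 ≤ k) {e q : V}
    (he : e ≠ 0) (hq : q ∉ Submodule.span ℚ {e}) : ¬ AffineInvariant B := by
  classical
  intro hB
  have hcard : ∀ b ∈ B, ∀ C : Finset V, ↑C ⊆ b → C.card ≤ k + 1 := fun b hb C hC =>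
    card_le_of_subset_block hS hB hk he hq hb hC
  let g : ℕ → V := fun i => (i : ℚ) • e
  have hg : Function.Injective g := natCast_smul_injective he
  have hrefl : ∀ i j : ℕ, ∀ c : ℚ, (i : ℚ) + j = 2 * c → (2 : ℚ) • c • e - g i = g j := by
    intro i j c h
    rw [smul_smul, ← h]
    simp only [g]
    module
  obtain ⟨m, rfl | rfl⟩ := Nat.even_or_odd' k
  · have hA : (((Finset.range (2 * m + 1)).erase m).image g).card = 2 * m := by
      rw [Finset.card_image_of_injective _ hg, Finset.card_erase_of_mem (by simp; omega)]
      simp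
    have hA' : ((Finset.Icc 1 (2 * m)).image g).card = 2 * m := by
      rw [Finset.card_image_of_injective _ hg]
      simp
    obtain ⟨b, hb, hAb⟩ := hS.exists_block hA
    have hc := (center_mem_block hS hB hcard hb hA hAb ((m : ℚ) • e) (by
      intro x hx
      obtain ⟨i, hi, rfl⟩ := Finset.mem_image.1 hx
      simp only [Finset.mem_erase, Finset.mem_range] at hi
      rw [hrefl i (2 * m - i) m (by rw [Nat.cast_sub (by omega)]; push_cast; ring)]
      refine Finset.mem_image_of_mem _ ?_
      simp only [Finset.mem_erase, Finset.mem_range]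
      omega)).2
    have hmem : ∀ i < 2 * m + 1, g i ∈ b := by
      intro i hi
      rcases eq_or_ne i m with rfl | him
      · exact hc
      · exact hAb (Finset.mem_coe.2 (Finset.mem_image_of_mem _ (by simp [him, hi])))
    have hA'b : (((Finset.Icc 1 (2 * m)).image g : Finset V) : Set V) ⊆ b := by
      intro x hx
      obtain ⟨i, hi, rfl⟩ := Finset.mem_image.1 (Finset.mem_coe.1 hx)
      exact hmem i (by simp at hi; omega)
    have hc' := (center_mem_block hS hB hcard hb hA' hA'b ((m + 1 / 2 : ℚ) • e) (by
      intro x hx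
      obtain ⟨i, hi, rfl⟩ := Finset.mem_image.1 hx
      simp only [Finset.mem_Icc] at hi
      rw [hrefl i (2 * m + 1 - i) _ (by rw [Nat.cast_sub (by omega)]; push_cast; ring)]
      refine Finset.mem_image_of_mem _ ?_
      simp only [Finset.mem_Icc]
      omega)).2
    have hnot : (m + 1 / 2 : ℚ) • e ∉ (Finset.range (2 * m + 1)).image g := by
      intro h
      obtain ⟨i, -, hi⟩ := Finset.mem_image.1 h
      have h1 : (i : ℚ) = m + 1 / 2 := smul_left_injective ℚ he hi
      have h2 : ((2 * i : ℕ) : ℚ) = ((2 * m + 1 : ℕ) : ℚ) := by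
        push_cast
        rw [h1]
        ring
      have := Nat.cast_injective h2
      omega
    have := hcard b hb (insert ((m + 1 / 2 : ℚ) • e) ((Finset.range (2 * m + 1)).image g)) (by
      intro x hx
      rcases Finset.mem_insert.1 (Finset.mem_coe.1 hx) with rfl | hx
      · exact hc'
      · obtain ⟨i, hi, rfl⟩ := Finset.mem_image.1 hx
        exact hmem i (Finset.mem_range.1 hi))
    rw [Finset.card_insert_of_notMem hnot, Finset.card_image_of_injective _ hg,
      Finset.card_range] at this
    omega
  · have hA : ((Finset.range (2 * m + 1)).image g).card = 2 * m + 1 := by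
      rw [Finset.card_image_of_injective _ hg, Finset.card_range]
    obtain ⟨b, hb, hAb⟩ := hS.exists_block hA
    refine (center_mem_block hS hB hcard hb hA hAb ((m : ℚ) • e) (by
      intro x hx
      obtain ⟨i, hi, rfl⟩ := Finset.mem_image.1 hx
      simp only [Finset.mem_range] at hi
      rw [hrefl i (2 * m - i) m (by rw [Nat.cast_sub (by omega)]; push_cast; ring)]
      refine Finset.mem_image_of_mem _ ?_
      simp only [Finset.mem_range]
      omega)).1 ?_
    exact Finset.mem_image.2 ⟨m, by simp; omega, rfl⟩

/-- The blocks of an affine invariant Steiner `2`-system are the lines. -/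
lemma block_eq_line (hS : IsSteinerSystem 2 B) (hB : AffineInvariant B) {b : Set V} (hb : b ∈ B)
    {x y : V} (hx : x ∈ b) (hy : y ∈ b) (hxy : x ≠ y) : b = lineThrough x (y - x) := by
  classical
  have hpair : ∀ {u v : V}, u ∈ b → v ∈ b → (({u, v} : Finset V) : Set V) ⊆ b := by
    intro u v hu hv
    simp [Set.insert_subset_iff, hu, hv]
  have hsub : b ⊆ lineThrough x (y - x) := by
    refine block_subset_line hS hB hb (Finset.card_pair hxy) (hpair hx hy) ?_
    intro z hz
    simp only [Finset.coe_insert, Finset.coe_singleton, Set.mem_insert_iff,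
      Set.mem_singleton_iff] at hz
    rcases hz with rfl | rfl
    · exact ⟨0, by simp⟩
    · exact ⟨1, by simp⟩
  let S : Set ℚ := {t | x + t • (y - x) ∈ b}
  have h0 : (0 : ℚ) ∈ S := by simpa [S] using hx
  have h1 : (1 : ℚ) ∈ S := by simpa [S] using hy
  have key : ∀ α β : ℚ, α ≠ 0 → β ∈ S → α + β ∈ S → ∀ t, α * t + β ∈ S ↔ t ∈ S := by
    intro α β hα hβ hαβ t
    have happ : ∀ t : ℚ, LinearEquiv.smulOfNeZero ℚ V α hα (x + t • (y - x)) +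
        (x + β • (y - x) - α • x) = x + (α * t + β) • (y - x) := by
      intro t
      rw [LinearEquiv.smulOfNeZero_apply]
      module
    have himg := image_eq_of_subset hS hB hb (Finset.card_pair hxy) (hpair hx hy)
      (LinearEquiv.smulOfNeZero ℚ V α hα) (x + β • (y - x) - α • x) (by
        intro z hz
        rcases Finset.mem_insert.1 hz with rfl | hz
        · have := happ 0
          rw [zero_smul, add_zero] at this
          rw [this]
          simpa [S] using hβ
        · rw [Finset.mem_singleton.1 hz]
          have := happ 1
          rw [one_smul, add_sub_cancel] at this
          rw [this]
          simpa [S] using hαβ)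
    constructor
    · intro h
      have h' : x + (α * t + β) • (y - x) ∈ b := h
      rw [← himg, ← happ] at h'
      obtain ⟨z, hz, hzt⟩ := h'
      have : z = x + t • (y - x) := (LinearEquiv.injective _) (add_right_cancel hzt)
      rw [this] at hz
      exact hz
    · intro h
      show x + (α * t + β) • (y - x) ∈ b
      rw [← himg, ← happ]
      exact ⟨_, h, rfl⟩
  have hmul : ∀ a ∈ S, a ≠ 0 → ∀ t, a * t ∈ S ↔ t ∈ S := by
    intro a ha ha0 t
    simpa using key a 0 ha0 h0 (by simpa using ha) t
  have hone : ∀ t ∈ S, 1 - t ∈ S := by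
    intro t ht
    have := (key (-1) 1 (by norm_num) h1 (by simpa using h0) t).2 ht
    rwa [neg_one_mul, neg_add_eq_sub] at this
  have hsub' : ∀ a ∈ S, a ≠ 0 → ∀ c ∈ S, a - c ∈ S := by
    intro a ha ha0 c hc
    have h2 : c / a ∈ S := (hmul a ha ha0 _).1 (by rwa [mul_div_cancel₀ _ ha0])
    have h3 := (hmul a ha ha0 _).2 (hone _ h2)
    rwa [mul_sub, mul_one, mul_div_cancel₀ _ ha0] at h3
  have hneg1 : (-1 : ℚ) ∈ S := by
    obtain ⟨A, hA, hAb⟩ := hS.exists_finset_subset hb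
    obtain ⟨z, hzA, hz⟩ := Finset.exists_mem_notMem_of_card_lt_card
      (by rw [Finset.card_pair hxy, hA]; omega : ({x, y} : Finset V).card < A.card)
    obtain ⟨s, rfl⟩ := hsub (hAb hzA)
    have hs : s ∈ S := hAb hzA
    simp only [Finset.mem_insert, Finset.mem_singleton, not_or] at hz
    have hs0 : s ≠ 0 := by
      rintro rfl
      simp at hz
    have hs1 : 1 - s ≠ 0 := by
      intro h
      have : s = 1 := by linarith
      subst this
      simp at hz
    have h2 := hsub' _ (hone s hs) hs1 1 h1
    refine (hmul s hs hs0 _).1 ?_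
    convert h2 using 1
    ring
  have hneg : ∀ a ∈ S, -a ∈ S := fun a ha => by
    have := (hmul (-1) hneg1 (by norm_num) a).2 ha
    rwa [neg_one_mul] at this
  have hnat : ∀ m : ℕ, (m : ℚ) ∈ S := by
    intro m
    induction m with
    | zero => simpa using h0
    | succ m ih =>
      have := hsub' 1 h1 one_ne_zero _ (hneg _ ih)
      rw [Nat.cast_succ]
      convert this using 1
      ring
  have hint : ∀ m : ℤ, (m : ℚ) ∈ S := by
    intro m
    obtain ⟨j, rfl | rfl⟩ := m.eq_nat_or_neg
    · simpa using hnat j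
    · simpa using hneg _ (hnat j)
  refine hsub.antisymm ?_
  rintro _ ⟨t, rfl⟩
  refine (hmul t.den (hnat _) (by simp) t).1 ?_
  rw [Rat.den_mul_eq_num]
  exact hint _

/-- A bijection of a vector space over `ℚ` of dimension at least two that fixes the origin and,
together with its inverse, maps lines into lines is additive. -/
lemma map_add_of_preserves_lines (hV : ∀ x : V, ∃ z, z ∉ Submodule.span ℚ {x})
    (τ : Equiv.Perm V) (hτ0 : τ 0 = 0)
    (hτ : ∀ x y (t : ℚ), ∃ s : ℚ, τ (x + t • (y - x)) = τ x + s • (τ y - τ x))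
    (hτ' : ∀ x y (t : ℚ), ∃ s : ℚ, τ.symm (x + t • (y - x)) =
      τ.symm x + s • (τ.symm y - τ.symm x)) (x y : V) : τ (x + y) = τ x + τ y := by
  have hτ0' : τ.symm 0 = 0 := by rw [Equiv.symm_apply_eq, hτ0]
  have hray : ∀ x (t : ℚ), ∃ s : ℚ, τ.symm (t • τ x) = s • x := by
    intro x t
    obtain ⟨s, hs⟩ := hτ' 0 (τ x) t
    exact ⟨s, by simpa [hτ0'] using hs⟩
  have hcoeff : ∀ x y (p r : ℚ), y ∉ Submodule.span ℚ {x} → τ (x + y) = p • τ x + r • τ y →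
      r = 1 := by
    intro x y p r hy h
    by_contra hr
    have hr' : 1 - r ≠ 0 := sub_ne_zero.2 (Ne.symm hr)
    obtain ⟨s, hs⟩ := hτ' (τ y) (τ (x + y)) (1 - r)⁻¹
    have hw : τ y + (1 - r)⁻¹ • (τ (x + y) - τ y) = ((1 - r)⁻¹ * p) • τ x := by
      rw [h]
      match_scalars <;> field_simp
      ring
    obtain ⟨s', hs'⟩ := hray x ((1 - r)⁻¹ * p)
    rw [hw, hs', Equiv.symm_apply_apply, Equiv.symm_apply_apply] at hs
    apply hy
    rw [Submodule.mem_span_singleton]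
    refine ⟨s' - s, ?_⟩
    rw [sub_smul, hs]
    module
  have hindep : ∀ x y, y ∉ Submodule.span ℚ {x} → τ (x + y) = τ x + τ y := by
    intro x y hy
    rcases eq_or_ne x 0 with rfl | hx
    · simp [hτ0]
    have hxy : x ∉ Submodule.span ℚ {y} := by
      intro h
      obtain ⟨t, ht⟩ := Submodule.mem_span_singleton.1 h
      have ht0 : t ≠ 0 := by
        rintro rfl
        exact hx (by rw [← ht, zero_smul])
      exact hy (Submodule.mem_span_singleton.2 ⟨t⁻¹, by rw [← ht, inv_smul_smul₀ ht0]⟩)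
    obtain ⟨μ, hμ⟩ := hτ x y (1 / 2)
    obtain ⟨l, hl⟩ := hτ 0 (x + (1 / 2 : ℚ) • (y - x)) 2
    have hsum : (0 : V) + (2 : ℚ) • (x + (1 / 2 : ℚ) • (y - x) - 0) = x + y := by module
    rw [hsum, hτ0, hμ] at hl
    have h1 : τ (x + y) = (l * (1 - μ)) • τ x + (l * μ) • τ y := by
      rw [hl]
      module
    have h2 : τ (y + x) = (l * μ) • τ y + (l * (1 - μ)) • τ x := by
      rw [add_comm, h1, add_comm]
    rw [h1, hcoeff _ _ _ _ hy h1, hcoeff _ _ _ _ hxy h2, one_smul, one_smul]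
  by_cases hy : y ∈ Submodule.span ℚ {x}
  · obtain ⟨z, hz⟩ := hV x
    have hx := Submodule.mem_span_singleton_self (R := ℚ) x
    have hle : ∀ w ∈ Submodule.span ℚ {x}, z ∉ Submodule.span ℚ {w} := fun w hw h =>
      hz ((Submodule.span_singleton_le_iff_mem _ _).2 hw h)
    have h1 := hindep x (y + z) fun h => hz ((Submodule.add_mem_iff_right _ hy).1 h)
    rw [hindep y z (hle y hy), ← add_assoc, hindep (x + y) z (hle _ (Submodule.add_mem _ hx hy)),
      ← add_assoc] at h1
    exact add_right_cancel h1
  · exact hindep x y hy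

/-- The fundamental theorem of affine geometry over `ℚ`. -/
lemma exists_linearEquiv_of_preserves_lines (hV : ∀ x : V, ∃ z, z ∉ Submodule.span ℚ {x})
    (σ : Equiv.Perm V)
    (hσ : ∀ x y (t : ℚ), ∃ s : ℚ, σ (x + t • (y - x)) = σ x + s • (σ y - σ x))
    (hσ' : ∀ x y (t : ℚ), ∃ s : ℚ, σ.symm (x + t • (y - x)) =
      σ.symm x + s • (σ.symm y - σ.symm x)) :
    ∃ T : V ≃ₗ[ℚ] V, ∀ x, σ x = T x + σ 0 := by
  let τ : Equiv.Perm V := σ.trans (Equiv.subRight (σ 0))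
  have hτ : ∀ x, τ x = σ x - σ 0 := fun x => rfl
  have hτ' : ∀ x, τ.symm x = σ.symm (x + σ 0) := fun x => rfl
  have hadd := map_add_of_preserves_lines hV τ (by simp [hτ])
    (by
      intro x y t
      obtain ⟨s, hs⟩ := hσ x y t
      refine ⟨s, ?_⟩
      rw [hτ, hτ, hτ, hs]
      module)
    (by
      intro x y t
      obtain ⟨s, hs⟩ := hσ' (x + σ 0) (y + σ 0) t
      refine ⟨s, ?_⟩
      rw [hτ', hτ', hτ', ← hs]
      congr 1
      module)
  refine ⟨LinearEquiv.ofBijective (AddMonoidHom.mk' τ hadd).toRatLinearMap τ.bijective,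
    fun x => ?_⟩
  show σ x = τ x + σ 0
  rw [hτ, sub_add_cancel]

/-- A permutation mapping blocks to blocks maps lines into lines. -/
lemma exists_smul_of_image_mem (hS : IsSteinerSystem 2 B) (hB : AffineInvariant B)
    (σ : Equiv.Perm V) (hσ : ∀ b ∈ B, σ '' b ∈ B) (x y : V) (t : ℚ) :
    ∃ s : ℚ, σ (x + t • (y - x)) = σ x + s • (σ y - σ x) := by
  classical
  rcases eq_or_ne x y with rfl | hxy
  · exact ⟨0, by simp⟩
  obtain ⟨b, hb, hAb⟩ := hS.exists_block (Finset.card_pair hxy)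
  have hx : x ∈ b := hAb (by simp)
  have hy : y ∈ b := hAb (by simp)
  have ht : x + t • (y - x) ∈ b := by
    rw [block_eq_line hS hB hb hx hy hxy]
    exact ⟨t, rfl⟩
  have := Set.mem_image_of_mem σ ht
  rw [block_eq_line hS hB (hσ b hb) (Set.mem_image_of_mem σ hx) (Set.mem_image_of_mem σ hy)
    (σ.injective.ne hxy)] at this
  obtain ⟨s, hs⟩ := this
  exact ⟨s, hs.symm⟩

end Affine

/-- For `n ≥ 2` and `k ≥ 2`, no group of permutations of `ℚ^n` properly containing
`AGL_n(ℚ)` preserves a Steiner `k`-system on `ℚ^n`. -/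
theorem proper_supergroup_preserves_no_steiner_system (n k : ℕ) (hn : 2 ≤ n) (hk : 2 ≤ k)
    (G : Subgroup (Equiv.Perm (Fin n → ℚ)))
    (hsub : ∀ σ : Equiv.Perm (Fin n → ℚ), IsAGL n σ → σ ∈ G)
    (hproper : ∃ σ ∈ G, ¬ IsAGL n σ) :
    ¬ ∃ B : Set (Set (Fin n → ℚ)), IsSteinerSystem k B ∧
      ∀ σ ∈ G, ∀ b ∈ B, (σ : Equiv.Perm (Fin n → ℚ)) '' b ∈ B := by
  rintro ⟨B, hS, hG⟩
  have hB : AffineInvariant B := fun T c b hb =>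
    hG (T.toEquiv.trans (Equiv.addRight c)) (hsub _ ⟨T, c, fun x => rfl⟩) b hb
  have hV : ∀ x : Fin n → ℚ, ∃ z, z ∉ Submodule.span ℚ {x} := by
    intro x
    by_contra! h
    have h1 : Submodule.span ℚ {x} = ⊤ := Submodule.eq_top_iff'.2 h
    have h2 := finrank_span_le_card (R := ℚ) ({x} : Set (Fin n → ℚ))
    rw [h1, finrank_top, Module.finrank_fin_fun] at h2
    simp at h2
    omega
  rcases hk.eq_or_lt with rfl | hk
  · obtain ⟨σ, hσ, hnot⟩ := hproper
    obtain ⟨T, hT⟩ := exists_linearEquiv_of_preserves_lines hV σ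
      (exists_smul_of_image_mem hS hB σ (hG σ hσ))
      (exists_smul_of_image_mem hS hB σ.symm (hG σ⁻¹ (G.inv_mem hσ)))
    exact hnot ⟨T, σ 0, hT⟩
  · obtain ⟨e, he⟩ := hV 0
    obtain ⟨q, hq⟩ := hV e
    refine not_affineInvariant_of_three_le hS hk (e := e) ?_ hq hB
    rintro rfl
    exact he (Submodule.zero_mem _)
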